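/- arXiv:2407.06804 — 5 statements merged into one kernel-verified Lean document; each statement's English description precedes it below -/
import Mathlib

section
/- Let a, b ∈ [1, ∞) be real numbers with 1/a + 1/b ≤ 3/2. Then for every positive integer N and every bilinear form A : ℝ^N × ℝ^N → ℝ, one has (∑_{k=1}^N (∑_{j=1}^N |A(e_k, e_j)|^a)^{b/a})^{1/b} ≤ 2^{max(0, 1/a + 1/b − 1)} · ‖A‖. -/
open Finset

/-- The supremum norm of a bilinear form on `ℝ^N × ℝ^N` over the unit polydisc
(the cube of vectors with all coordinates of absolute value at most 1). -/
noncomputable def bilinNorm (N : ℕ) (A : (Fin N → ℝ) →ₗ[ℝ] (Fin N → ℝ) →ₗ[ℝ] ℝ) : ℝ :=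
  sSup { t : ℝ | ∃ x y : Fin N → ℝ, (∀ i, |x i| ≤ 1) ∧ (∀ j, |y j| ≤ 1) ∧ t = |A x y| }

/-! ### Averages over the discrete cube -/

/-- Average over the cube. -/
noncomputable def cubeE {n : ℕ} (f : (Fin n → Bool) → ℝ) : ℝ := (∑ x, f x) / 2 ^ n

/-- The sign attached to a boolean. -/
noncomputable def sg (b : Bool) : ℝ := if b then 1 else -1

/-- Flip one coordinate. -/
def flipAt {n : ℕ} (i : Fin n) (x : Fin n → Bool) : Fin n → Bool := Function.update x i (!x i)

theorem cubeE_add {n : ℕ} (f g : (Fin n → Bool) → ℝ) :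
    cubeE (fun x => f x + g x) = cubeE f + cubeE g := by
  simp [cubeE, Finset.sum_add_distrib, add_div]

theorem cubeE_const_mul {n : ℕ} (c : ℝ) (f : (Fin n → Bool) → ℝ) :
    cubeE (fun x => c * f x) = c * cubeE f := by
  simp [cubeE, ← Finset.mul_sum, mul_div_assoc]

theorem cubeE_mono {n : ℕ} {f g : (Fin n → Bool) → ℝ} (h : ∀ x, f x ≤ g x) :
    cubeE f ≤ cubeE g := by
  unfold cubeE
  gcongr with x
  exact h x

theorem cubeE_const {n : ℕ} (c : ℝ) : cubeE (fun _ : Fin n → Bool => c) = c := by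
  simp [cubeE]

theorem cubeE_nonneg {n : ℕ} {f : (Fin n → Bool) → ℝ} (h : ∀ x, 0 ≤ f x) : 0 ≤ cubeE f := by
  have := cubeE_mono (f := fun _ => 0) h
  rwa [cubeE_const] at this

theorem cubeE_sum {n : ℕ} {ι : Type*} (s : Finset ι) (f : ι → (Fin n → Bool) → ℝ) :
    cubeE (fun x => ∑ i ∈ s, f i x) = ∑ i ∈ s, cubeE (f i) := by
  unfold cubeE
  rw [Finset.sum_comm, Finset.sum_div]

theorem cubeE_succ {n : ℕ} (f : (Fin (n + 1) → Bool) → ℝ) :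
    cubeE f = cubeE (fun x : Fin n → Bool =>
      (f (Fin.cons true x : Fin (n + 1) → Bool) + f (Fin.cons false x : Fin (n + 1) → Bool)) / 2) := by
  unfold cubeE
  rw [← (Fin.consEquiv (fun _ : Fin (n + 1) => Bool)).sum_comp, Fintype.sum_prod_type]
  simp only [Fin.consEquiv, Equiv.coe_fn_mk, Fintype.sum_bool, ← Finset.sum_add_distrib,
    ← Finset.sum_div]
  rw [pow_succ]
  field_simp

theorem flipAt_flipAt {n : ℕ} (i : Fin n) (x : Fin n → Bool) : flipAt i (flipAt i x) = x := by
  simp [flipAt]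

theorem cubeE_flip {n : ℕ} (i : Fin n) (f : (Fin n → Bool) → ℝ) :
    cubeE (fun x => f (flipAt i x)) = cubeE f := by
  unfold cubeE
  congr 1
  exact Equiv.sum_comp (Function.Involutive.toPerm (flipAt i) (flipAt_flipAt i)) f

theorem cubeE_neg {n : ℕ} (f : (Fin n → Bool) → ℝ) :
    cubeE (fun x => f (fun i => !x i)) = cubeE f := by
  unfold cubeE
  congr 1
  exact Equiv.sum_comp (Function.Involutive.toPerm (fun (x : Fin n → Bool) i => !x i)
    (fun x => by simp)) f

theorem cubeE_sq_le {n : ℕ} (f : (Fin n → Bool) → ℝ) :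
    (cubeE f) ^ 2 ≤ cubeE (fun x => f x ^ 2) := by
  have h : 0 ≤ cubeE (fun x => (f x ^ 2 + (-2 * cubeE f) * f x) + (cubeE f) ^ 2) :=
    cubeE_nonneg fun x => by nlinarith [sq_nonneg (f x - cubeE f)]
  rw [cubeE_add, cubeE_add, cubeE_const_mul, cubeE_const] at h
  nlinarith

theorem flipAt_zero_cons {n : ℕ} (b : Bool) (x : Fin n → Bool) :
    flipAt 0 (Fin.cons b x : Fin (n + 1) → Bool) = (Fin.cons (!b) x : Fin (n + 1) → Bool) := by
  simp [flipAt, Fin.update_cons_zero]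

theorem flipAt_succ_cons {n : ℕ} (i : Fin n) (b : Bool) (x : Fin n → Bool) :
    flipAt i.succ (Fin.cons b x : Fin (n + 1) → Bool)
      = (Fin.cons b (flipAt i x) : Fin (n + 1) → Bool) := by
  simp [flipAt, Fin.cons_update]

/-- Dirichlet form. -/
noncomputable def dirich {n : ℕ} (f : (Fin n → Bool) → ℝ) : ℝ :=
  ∑ i, cubeE (fun x => (f x - f (flipAt i x)) ^ 2)

noncomputable def gpart {n : ℕ} (f : (Fin (n + 1) → Bool) → ℝ) (x : Fin n → Bool) : ℝ :=
  (f (Fin.cons true x : Fin (n + 1) → Bool) + f (Fin.cons false x : Fin (n + 1) → Bool)) / 2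

noncomputable def hpart {n : ℕ} (f : (Fin (n + 1) → Bool) → ℝ) (x : Fin n → Bool) : ℝ :=
  (f (Fin.cons true x : Fin (n + 1) → Bool) - f (Fin.cons false x : Fin (n + 1) → Bool)) / 2

theorem cubeE_gpart {n : ℕ} (f : (Fin (n + 1) → Bool) → ℝ) : cubeE f = cubeE (gpart f) :=
  cubeE_succ f

theorem cubeE_sq_succ {n : ℕ} (f : (Fin (n + 1) → Bool) → ℝ) :
    cubeE (fun x => f x ^ 2) = cubeE (fun x => gpart f x ^ 2) + cubeE (fun x => hpart f x ^ 2) := by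
  rw [cubeE_succ, ← cubeE_add]
  congr 1; funext x; simp only [gpart, hpart]; ring

theorem dirich_succ {n : ℕ} (f : (Fin (n + 1) → Bool) → ℝ) :
    dirich f = 4 * cubeE (fun x => hpart f x ^ 2) + dirich (gpart f) + dirich (hpart f) := by
  unfold dirich
  rw [Fin.sum_univ_succ, add_assoc, ← Finset.sum_add_distrib]
  congr 1
  · rw [cubeE_succ, ← cubeE_const_mul]
    congr 1; funext x
    simp only [flipAt_zero_cons, hpart, Bool.not_true, Bool.not_false]; ring
  · refine Finset.sum_congr rfl fun i _ => ?_
    rw [cubeE_succ, ← cubeE_add]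
    congr 1; funext x
    simp only [flipAt_succ_cons, hpart, gpart]; ring

theorem poincare : ∀ (n : ℕ) (f : (Fin n → Bool) → ℝ),
    cubeE (fun x => f x ^ 2) - (cubeE f) ^ 2 ≤ 1 / 4 * dirich f := by
  intro n
  induction n with
  | zero => intro f; simp [cubeE, dirich]
  | succ n ih =>
    intro f
    rw [cubeE_sq_succ, cubeE_gpart, dirich_succ]
    have h1 := ih (gpart f)
    have h2 : 0 ≤ dirich (hpart f) :=
      Finset.sum_nonneg fun i _ => cubeE_nonneg fun x => sq_nonneg _
    linarith

theorem poincare2 : ∀ (n : ℕ) (f : (Fin n → Bool) → ℝ),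
    2 * (cubeE (fun x => f x ^ 2) - (cubeE f) ^ 2) - ∑ i, (cubeE (fun x => sg (x i) * f x)) ^ 2
      ≤ 1 / 4 * dirich f := by
  intro n
  induction n with
  | zero => intro f; simp [cubeE, dirich]
  | succ n ih =>
    intro f
    have e0 : cubeE (fun x => sg (x 0) * f x) = cubeE (hpart f) := by
      rw [cubeE_succ]; congr 1; funext x; simp [hpart, sg]; ring
    have e1 : ∀ i : Fin n, cubeE (fun x => sg (x i.succ) * f x)
        = cubeE (fun x => sg (x i) * gpart f x) := by
      intro i
      rw [cubeE_succ]; congr 1; funext x; simp only [gpart, Fin.cons_succ]; ring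
    rw [cubeE_sq_succ, cubeE_gpart, dirich_succ, Fin.sum_univ_succ, e0]
    simp only [e1]
    have h1 := ih (gpart f)
    have h2 := poincare n (hpart f)
    linarith

/-! ### Khinchine -/

noncomputable def rad {n : ℕ} (a : Fin n → ℝ) (x : Fin n → Bool) : ℝ := ∑ i, a i * sg (x i)

theorem sg_not (b : Bool) : sg (!b) = - sg b := by cases b <;> simp [sg]

theorem sg_abs (b : Bool) : |sg b| = 1 := by cases b <;> simp [sg]

theorem rad_flip {n : ℕ} (a : Fin n → ℝ) (i : Fin n) (x : Fin n → Bool) :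
    rad a (flipAt i x) = rad a x - 2 * (a i * sg (x i)) := by
  have : ∀ j, a j * sg (flipAt i x j) = a j * sg (x j) - if j = i then 2 * (a i * sg (x i)) else 0 := by
    intro j
    by_cases h : j = i
    · subst h; simp [flipAt, sg_not]; ring
    · simp [flipAt, h]
  simp [rad, this, Finset.sum_sub_distrib]

theorem rad_sq : ∀ (n : ℕ) (a : Fin n → ℝ), cubeE (fun x => rad a x ^ 2) = ∑ i, a i ^ 2 := by
  intro n
  induction n with
  | zero => intro a; simp [cubeE, rad]
  | succ n ih =>
    intro a
    rw [cubeE_succ, Fin.sum_univ_succ, ← ih (fun i => a i.succ), ← cubeE_const (n := n) (a 0 ^ 2),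
      ← cubeE_add]
    congr 1; funext x
    simp [rad, Fin.sum_univ_succ, sg]; ring

theorem khinchine {n : ℕ} (a : Fin n → ℝ) :
    ∑ i, a i ^ 2 ≤ 2 * (cubeE (fun x => |rad a x|)) ^ 2 := by
  set f : (Fin n → Bool) → ℝ := fun x => |rad a x| with hf
  have hsq : cubeE (fun x => f x ^ 2) = ∑ i, a i ^ 2 := by
    rw [← rad_sq]; simp [hf]
  have hodd : ∀ i, cubeE (fun x => sg (x i) * f x) = 0 := by
    intro i
    have h := cubeE_neg (fun x => sg (x i) * f x)
    have h2 : (fun x : Fin n → Bool => sg (!x i) * f (fun i => !x i))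
        = fun x => (-1) * (sg (x i) * f x) := by
      funext x
      have : f (fun i => !x i) = f x := by
        simp only [hf, rad, sg_not, mul_neg, Finset.sum_neg_distrib, abs_neg]
      rw [this, sg_not]; ring
    simp only at h
    rw [h2, cubeE_const_mul] at h
    linarith
  have hd : dirich f ≤ 4 * cubeE (fun x => f x ^ 2) := by
    have e : ∀ i, cubeE (fun x => (f x - f (flipAt i x)) ^ 2)
        = cubeE (fun x => 2 * (f x * (f x - f (flipAt i x)))) := by
      intro i
      have h1 := cubeE_flip i (fun x => f x * (f x - f (flipAt i x)))
      simp only [flipAt_flipAt] at h1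
      rw [cubeE_const_mul, two_mul]
      nth_rewrite 1 [← h1]
      rw [← cubeE_add]
      congr 1; funext x; ring
    unfold dirich
    simp only [e]
    rw [← cubeE_sum, ← cubeE_const_mul]
    refine cubeE_mono fun x => ?_
    rw [← Finset.mul_sum, ← Finset.mul_sum]
    have hx : 0 ≤ f x := abs_nonneg _
    have key : ∑ i, (f x - f (flipAt i x)) ≤ 2 * f x := by
      have h1 : |∑ i, rad a (flipAt i x)| ≤ ∑ i, f (flipAt i x) := Finset.abs_sum_le_sum_abs _ _
      have h2 : ∑ i, rad a (flipAt i x) = ((n : ℝ) - 2) * rad a x := by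
        simp only [rad_flip, Finset.sum_sub_distrib, ← Finset.mul_sum]
        simp [rad]; ring
      rw [h2, abs_mul] at h1
      have h3 : ((n : ℝ) - 2) * f x ≤ |(n : ℝ) - 2| * f x := by
        gcongr; exact le_abs_self _
      rw [Finset.sum_sub_distrib]
      simp only [Finset.sum_const, Finset.card_univ, Fintype.card_fin, nsmul_eq_mul]
      have h4 : |(n : ℝ) - 2| * f x ≤ ∑ i, f (flipAt i x) := h1
      linarith
    nlinarith
  have hp := poincare2 n f
  simp only [hodd] at hp
  rw [← hsq]
  simp at hp
  linarith

theorem abs_le_cubeE_rad {n : ℕ} (a : Fin n → ℝ) (i : Fin n) :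
    |a i| ≤ cubeE (fun x => |rad a x|) := by
  have h1 := cubeE_flip i (fun x => |rad a x|)
  have h2 : cubeE (fun _ : Fin n → Bool => 2 * |a i|)
      ≤ cubeE (fun x => |rad a x| + |rad a (flipAt i x)|) := by
    refine cubeE_mono fun x => ?_
    have h := abs_sub (rad a x) (rad a (flipAt i x))
    have h' : rad a x - rad a (flipAt i x) = 2 * (a i * sg (x i)) := by rw [rad_flip]; ring
    rw [h', abs_mul, abs_mul, sg_abs] at h
    simpa using h
  rw [cubeE_const, cubeE_add, h1] at h2
  linarith

theorem sum_rpow_le_rad {n : ℕ} (a : Fin n → ℝ) (p : ℝ) (hp : 2 ≤ p) :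
    ∑ i, |a i| ^ p ≤ 2 * (cubeE (fun x => |rad a x|)) ^ p := by
  set M := cubeE (fun x => |rad a x|) with hM
  have hM0 : 0 ≤ M := cubeE_nonneg fun x => abs_nonneg _
  have e : ∀ t : ℝ, 0 ≤ t → t ^ p = t ^ (p - 2) * t ^ 2 := by
    intro t ht
    rw [← Real.rpow_natCast, ← Real.rpow_add_of_nonneg ht (by linarith) (by norm_num)]
    congr 1; push_cast; ring
  calc ∑ i, |a i| ^ p ≤ ∑ i, M ^ (p - 2) * a i ^ 2 := by
        refine Finset.sum_le_sum fun i _ => ?_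
        rw [e _ (abs_nonneg _), sq_abs]
        gcongr
        exact abs_le_cubeE_rad a i
    _ = M ^ (p - 2) * ∑ i, a i ^ 2 := by rw [Finset.mul_sum]
    _ ≤ M ^ (p - 2) * (2 * M ^ 2) := by
        gcongr; exact khinchine a
    _ = 2 * M ^ p := by rw [e M hM0]; ring

/-! ### Inequalities for sums -/

theorem holder_weighted {ι : Type*} (s : Finset ι) (x y : ι → ℝ) (hx : ∀ i, 0 ≤ x i)
    (hy : ∀ i, 0 ≤ y i) (α : ℝ) (h0 : 0 ≤ α) (h1 : α ≤ 1) :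
    ∑ i ∈ s, x i ^ α * y i ^ (1 - α) ≤ (∑ i ∈ s, x i) ^ α * (∑ i ∈ s, y i) ^ (1 - α) := by
  rcases h0.eq_or_lt with rfl | h0
  · simp
  rcases h1.eq_or_lt with rfl | h1
  · simp
  have hc : (1 / α).HolderConjugate (1 / (1 - α)) := by
    rw [Real.holderConjugate_iff]
    refine ⟨by rw [lt_div_iff₀ h0]; linarith, ?_⟩
    simp
  have h := Real.inner_le_Lp_mul_Lq_of_nonneg s hc (f := fun i => x i ^ α)
    (g := fun i => y i ^ (1 - α)) (fun i _ => Real.rpow_nonneg (hx i) _)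
    (fun i _ => Real.rpow_nonneg (hy i) _)
  have hα : α * (1 / α) = 1 := by field_simp
  have hα' : (1 - α) * (1 / (1 - α)) = 1 := by
    have : 1 - α ≠ 0 := by linarith
    field_simp
  simpa only [← Real.rpow_mul (hx _), ← Real.rpow_mul (hy _), hα, hα', Real.rpow_one,
    one_div_one_div] using h

theorem minkowski_sum {ι κ : Type*} (s : Finset ι) (t : Finset κ) (f : ι → κ → ℝ)
    (hf : ∀ i j, 0 ≤ f i j) (p : ℝ) (hp : 1 ≤ p) :
    (∑ k ∈ s, (∑ j ∈ t, f k j) ^ p) ^ (1 / p) ≤ ∑ j ∈ t, (∑ k ∈ s, f k j ^ p) ^ (1 / p) := by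
  classical
  induction t using Finset.induction_on with
  | empty =>
    have : p ≠ 0 := by linarith
    simp [Real.zero_rpow this, Real.zero_rpow (inv_ne_zero this)]
  | insert j t hj ih =>
    simp only [Finset.sum_insert hj]
    refine (Real.Lp_add_le_of_nonneg s hp (f := fun k => f k j) (g := fun k => ∑ j ∈ t, f k j)
      (fun k _ => hf k j) (fun k _ => Finset.sum_nonneg fun j _ => hf k j)).trans ?_
    gcongr

/-! ### Matrices -/

/-- `C` bounds the matrix as a bilinear form on the cube. -/
def MBound {N : ℕ} (M : Fin N → Fin N → ℝ) (C : ℝ) : Prop :=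
  ∀ x y : Fin N → ℝ, (∀ i, |x i| ≤ 1) → (∀ j, |y j| ≤ 1) → |∑ k, ∑ j, x k * y j * M k j| ≤ C

theorem MBound.transpose {N : ℕ} {M : Fin N → Fin N → ℝ} {C : ℝ} (h : MBound M C) :
    MBound (fun k j => M j k) C := by
  intro x y hx hy
  have := h y x hy hx
  rw [Finset.sum_comm] at this
  refine le_trans (le_of_eq ?_) this
  congr 1
  exact Finset.sum_congr rfl fun k _ => Finset.sum_congr rfl fun j _ => by ring

theorem MBound.nonneg {N : ℕ} {M : Fin N → Fin N → ℝ} {C : ℝ} (h : MBound M C) : 0 ≤ C :=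
  (abs_nonneg _).trans (h (fun _ => 0) (fun _ => 0) (by simp) (by simp))

theorem MBound.sum_abs {N : ℕ} {M : Fin N → Fin N → ℝ} {C : ℝ} (h : MBound M C)
    (y : Fin N → ℝ) (hy : ∀ j, |y j| ≤ 1) : ∑ k, |∑ j, M k j * y j| ≤ C := by
  have h1 := h (fun k => if 0 ≤ ∑ j, M k j * y j then 1 else -1) y
    (fun i => by split_ifs <;> simp) hy
  refine le_trans (le_of_eq ?_) ((le_abs_self _).trans h1)
  refine Finset.sum_congr rfl fun k _ => ?_
  simp only [mul_assoc, ← Finset.mul_sum]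
  have : ∑ j, y j * M k j = ∑ j, M k j * y j := Finset.sum_congr rfl fun j _ => mul_comm _ _
  rw [this]
  split_ifs with h0
  · rw [abs_of_nonneg h0, one_mul]
  · rw [abs_of_neg (not_le.1 h0)]; ring

theorem MBound.sum_rad {N : ℕ} {M : Fin N → Fin N → ℝ} {C : ℝ} (h : MBound M C) :
    ∑ k, cubeE (fun x => |rad (M k) x|) ≤ C := by
  rw [← cubeE_sum, ← cubeE_const (n := N) C]
  exact cubeE_mono fun x => h.sum_abs (fun j => sg (x j)) (fun j => (sg_abs _).le)

theorem MBound.row {N : ℕ} {M : Fin N → Fin N → ℝ} {C : ℝ} (h : MBound M C) (k : Fin N) :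
    ∑ j, |M k j| ≤ C := by
  have h1 := h.transpose.sum_abs (Pi.single k 1) (fun j => by
    by_cases hj : j = k
    · subst hj; simp
    · simp [hj])
  simpa [Pi.single_apply] using h1

theorem MBound.fact1 {N : ℕ} {M : Fin N → Fin N → ℝ} {C : ℝ} (h : MBound M C) (p : ℝ)
    (hp : 2 ≤ p) : ∑ k, (∑ j, |M k j| ^ p) ^ (1 / p) ≤ 2 ^ (1 / p) * C := by
  have hp0 : 0 < p := by linarith
  calc ∑ k, (∑ j, |M k j| ^ p) ^ (1 / p)
      ≤ ∑ k, 2 ^ (1 / p) * cubeE (fun x => |rad (M k) x|) := by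
        refine Finset.sum_le_sum fun k _ => ?_
        have hM0 : 0 ≤ cubeE (fun x => |rad (M k) x|) := cubeE_nonneg fun x => abs_nonneg _
        calc (∑ j, |M k j| ^ p) ^ (1 / p)
            ≤ (2 * (cubeE (fun x => |rad (M k) x|)) ^ p) ^ (1 / p) := by
              refine Real.rpow_le_rpow ?_ (sum_rpow_le_rad (M k) p hp) (by positivity)
              exact Finset.sum_nonneg fun j _ => Real.rpow_nonneg (abs_nonneg _) _
          _ = _ := by
              rw [Real.mul_rpow (by norm_num) (Real.rpow_nonneg hM0 _), ← Real.rpow_mul hM0,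
                mul_one_div_cancel hp0.ne', Real.rpow_one]
    _ ≤ _ := by
        rw [← Finset.mul_sum]
        gcongr
        exact h.sum_rad

theorem MBound.fact2 {N : ℕ} {M : Fin N → Fin N → ℝ} {C : ℝ} (h : MBound M C) (p : ℝ)
    (hp : 2 ≤ p) : ∑ k, (∑ j, |M k j|) ^ p ≤ (2 ^ (1 / p) * C) ^ p := by
  have hp0 : 0 < p := by linarith
  have hS : 0 ≤ ∑ k, (∑ j, |M k j|) ^ p := Finset.sum_nonneg fun k _ =>
    Real.rpow_nonneg (Finset.sum_nonneg fun j _ => abs_nonneg _) _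
  have h1 := (minkowski_sum Finset.univ Finset.univ (fun k j => |M k j|)
    (fun _ _ => abs_nonneg _) p (by linarith)).trans (h.transpose.fact1 p hp)
  have h2 := Real.rpow_le_rpow (Real.rpow_nonneg hS _) h1 hp0.le
  rwa [← Real.rpow_mul hS, one_div_mul_cancel hp0.ne', Real.rpow_one] at h2

theorem MBound.case_low {N : ℕ} {M : Fin N → Fin N → ℝ} {C : ℝ} (h : MBound M C) (a b : ℝ)
    (ha : 1 ≤ a) (hb : 1 ≤ b) (hab : 1 / a + 1 / b ≤ 1) :
    ∑ k, (∑ j, |M k j| ^ a) ^ (b / a) ≤ C ^ b := by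
  have ha0 : 0 < a := by linarith
  have hb0 : 0 < b := by linarith
  have hC := h.nonneg
  set e := (a - 1) * (b / a) with he
  have he1 : 1 ≤ e := by
    rw [div_add_div _ _ ha0.ne' hb0.ne', div_le_one (by positivity)] at hab
    rw [he, mul_div_assoc', le_div_iff₀ ha0]
    nlinarith
  have hba : 0 ≤ b / a := by positivity
  have hM0 : ∀ k, 0 ≤ cubeE (fun x => |rad (M k) x|) := fun k => cubeE_nonneg fun x => abs_nonneg _
  have hMC : ∀ k, cubeE (fun x => |rad (M k) x|) ≤ C := fun k =>
    (Finset.single_le_sum (f := fun k => cubeE (fun x => |rad (M k) x|)) (fun k _ => hM0 k)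
      (Finset.mem_univ k)).trans h.sum_rad
  have split : ∀ (t u : ℝ), 0 ≤ t → 1 ≤ u → t ^ u = t ^ (u - 1) * t := by
    intro t u ht hu
    nth_rewrite 3 [← Real.rpow_one t]
    rw [← Real.rpow_add_of_nonneg ht (by linarith) zero_le_one]
    congr 1; ring
  have row : ∀ k, (∑ j, |M k j| ^ a) ^ (b / a)
      ≤ C ^ (e - 1) * C ^ (b / a) * cubeE (fun x => |rad (M k) x|) := by
    intro k
    set m := cubeE (fun x => |rad (M k) x|) with hm
    have h1 : ∑ j, |M k j| ^ a ≤ m ^ (a - 1) * C := by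
      calc ∑ j, |M k j| ^ a ≤ ∑ j, m ^ (a - 1) * |M k j| := by
            refine Finset.sum_le_sum fun j _ => ?_
            rw [split _ a (abs_nonneg _) ha]
            gcongr
            exact abs_le_cubeE_rad (M k) j
        _ ≤ _ := by
            rw [← Finset.mul_sum]
            have := Real.rpow_nonneg (hM0 k) (a - 1)
            gcongr
            exact h.row k
    calc (∑ j, |M k j| ^ a) ^ (b / a) ≤ (m ^ (a - 1) * C) ^ (b / a) :=
          Real.rpow_le_rpow (Finset.sum_nonneg fun j _ => Real.rpow_nonneg (abs_nonneg _) _) h1 hba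
      _ = m ^ e * C ^ (b / a) := by
          rw [Real.mul_rpow (Real.rpow_nonneg (hM0 k) _) hC, ← Real.rpow_mul (hM0 k)]
      _ = m ^ (e - 1) * C ^ (b / a) * m := by rw [split m e (hM0 k) he1]; ring
      _ ≤ _ := by
          have := hM0 k
          have h3 : m ^ (e - 1) ≤ C ^ (e - 1) :=
            Real.rpow_le_rpow (hM0 k) (hMC k) (by linarith)
          have := Real.rpow_nonneg hC (b / a)
          gcongr
  calc ∑ k, (∑ j, |M k j| ^ a) ^ (b / a)
      ≤ ∑ k, C ^ (e - 1) * C ^ (b / a) * cubeE (fun x => |rad (M k) x|) :=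
        Finset.sum_le_sum fun k _ => row k
    _ ≤ C ^ (e - 1) * C ^ (b / a) * C := by
        rw [← Finset.mul_sum]
        have := h.sum_rad
        gcongr
    _ = C ^ e * C ^ (b / a) := by rw [split C e hC he1]; ring
    _ = C ^ b := by
        rw [← Real.rpow_add_of_nonneg hC (by linarith) hba]
        congr 1
        rw [he]; field_simp; ring

theorem MBound.case_high {N : ℕ} {M : Fin N → Fin N → ℝ} {C : ℝ} (h : MBound M C) (a b p : ℝ)
    (ha : 1 ≤ a) (hb : 1 ≤ b) (hp : 2 ≤ p) (hab : 1 / a + 1 / b = 1 + 1 / p) :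
    ∑ k, (∑ j, |M k j| ^ a) ^ (b / a) ≤ (2 ^ (1 / p) * C) ^ b := by
  have ha0 : 0 < a := by linarith
  have hb0 : 0 < b := by linarith
  have hp0 : 0 < p := by linarith
  have hp1 : 0 < p - 1 := by linarith
  set D := 2 ^ (1 / p) * C with hD
  have hD0 : 0 ≤ D := mul_nonneg (by positivity) h.nonneg
  have hba : 0 ≤ b / a := by positivity
  have hap : a ≤ p := by
    have : 1 / b ≤ 1 := by rw [div_le_one hb0]; exact hb
    have : 1 / p ≤ 1 / a := by linarith
    exact (one_div_le_one_div hp0 ha0).1 this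
  have hab' : b * p + a * p = a * b * p + a * b := by
    field_simp at hab; linarith
  set α := (p - a) / (p - 1) with hα
  have hα0 : 0 ≤ α := div_nonneg (by linarith) hp1.le
  have hα1 : α ≤ 1 := by rw [hα, div_le_one hp1]; linarith
  have haα : α + p * (1 - α) = a := by
    rw [hα]; field_simp; ring
  set β := α * (b / a) / p with hβ
  have hβ0 : 0 ≤ β := by positivity
  have hβ1 : 1 - β = p * ((1 - α) * (b / a)) := by
    have h1 : (1 - α) * p = a - α := by linarith
    have h2 : α * (p - 1) = p - a := by rw [hα]; field_simp
    have h3 : b / a * (α + p * p * (1 - α)) = p := by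
      rw [div_mul_eq_mul_div, div_eq_iff ha0.ne']
      have : α + p * p * (1 - α) = a * p + a - p := by nlinarith
      rw [this]; linarith
    rw [hβ]
    field_simp
    field_simp at h3
    linarith
  have hβle : β ≤ 1 := by
    have : 0 ≤ p * ((1 - α) * (b / a)) :=
      mul_nonneg hp0.le (mul_nonneg (by linarith) hba)
    linarith
  set F : Fin N → ℝ := fun k => ∑ j, |M k j| with hF
  set G : Fin N → ℝ := fun k => ∑ j, |M k j| ^ p with hG
  have hF0 : ∀ k, 0 ≤ F k := fun k => Finset.sum_nonneg fun j _ => abs_nonneg _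
  have hG0 : ∀ k, 0 ≤ G k := fun k => Finset.sum_nonneg fun j _ => Real.rpow_nonneg (abs_nonneg _) _
  have row : ∀ k, (∑ j, |M k j| ^ a) ^ (b / a) ≤ (F k ^ p) ^ β * (G k ^ (1 / p)) ^ (1 - β) := by
    intro k
    have h1 : ∑ j, |M k j| ^ a ≤ F k ^ α * G k ^ (1 - α) := by
      refine le_trans (le_of_eq ?_) (holder_weighted Finset.univ (fun j => |M k j|)
        (fun j => |M k j| ^ p) (fun j => abs_nonneg _)
        (fun j => Real.rpow_nonneg (abs_nonneg _) _) α hα0 hα1)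
      refine Finset.sum_congr rfl fun j _ => ?_
      rw [← Real.rpow_mul (abs_nonneg _), ← Real.rpow_add_of_nonneg (abs_nonneg _) hα0
        (mul_nonneg hp0.le (by linarith)), haα]
    refine (Real.rpow_le_rpow (Finset.sum_nonneg fun j _ => Real.rpow_nonneg (abs_nonneg _) _)
      h1 hba).trans (le_of_eq ?_)
    rw [Real.mul_rpow (Real.rpow_nonneg (hF0 k) _) (Real.rpow_nonneg (hG0 k) _),
      ← Real.rpow_mul (hF0 k), ← Real.rpow_mul (hG0 k), ← Real.rpow_mul (hF0 k),
      ← Real.rpow_mul (hG0 k)]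
    congr 2
    · rw [hβ]; field_simp
    · rw [hβ1]; field_simp
  calc ∑ k, (∑ j, |M k j| ^ a) ^ (b / a)
      ≤ ∑ k, (F k ^ p) ^ β * (G k ^ (1 / p)) ^ (1 - β) := Finset.sum_le_sum fun k _ => row k
    _ ≤ (∑ k, F k ^ p) ^ β * (∑ k, G k ^ (1 / p)) ^ (1 - β) :=
        holder_weighted Finset.univ _ _ (fun k => Real.rpow_nonneg (hF0 k) _)
          (fun k => Real.rpow_nonneg (hG0 k) _) β hβ0 hβle
    _ ≤ (D ^ p) ^ β * D ^ (1 - β) := by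
        have hf : ∑ k, F k ^ p ≤ D ^ p := h.fact2 p hp
        have hg : ∑ k, G k ^ (1 / p) ≤ D := h.fact1 p hp
        have e1 : 0 ≤ ∑ k, F k ^ p := Finset.sum_nonneg fun k _ => Real.rpow_nonneg (hF0 k) _
        have e2 : 0 ≤ ∑ k, G k ^ (1 / p) := Finset.sum_nonneg fun k _ => Real.rpow_nonneg (hG0 k) _
        exact mul_le_mul (Real.rpow_le_rpow e1 hf hβ0) (Real.rpow_le_rpow e2 hg (by linarith))
          (Real.rpow_nonneg e2 _) (Real.rpow_nonneg (Real.rpow_nonneg hD0 _) _)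
    _ = D ^ b := by
        rw [← Real.rpow_mul hD0, ← Real.rpow_add_of_nonneg hD0 (by positivity) (by linarith)]
        congr 1
        rw [hβ1, hβ]
        have : p * (α * (b / a) / p) + p * ((1 - α) * (b / a)) = (α + p * (1 - α)) * (b / a) := by
          field_simp
        rw [this, haα]; field_simp

theorem bilin_expand {N : ℕ} (A : (Fin N → ℝ) →ₗ[ℝ] (Fin N → ℝ) →ₗ[ℝ] ℝ) (x y : Fin N → ℝ) :
    A x y = ∑ k, ∑ j, x k * y j * A (Pi.single k 1) (Pi.single j 1) := by
  conv_lhs => rw [pi_eq_sum_univ' x, pi_eq_sum_univ' y]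
  simp only [map_sum, map_smul, LinearMap.sum_apply, LinearMap.smul_apply, smul_eq_mul,
    Finset.mul_sum]
  rw [Finset.sum_comm]
  refine Finset.sum_congr rfl fun k _ => Finset.sum_congr rfl fun j _ => ?_
  ring

theorem mbound_bilinNorm {N : ℕ} (A : (Fin N → ℝ) →ₗ[ℝ] (Fin N → ℝ) →ₗ[ℝ] ℝ) :
    MBound (fun k j => A (Pi.single k 1) (Pi.single j 1)) (bilinNorm N A) := by
  intro x y hx hy
  rw [← bilin_expand]
  refine le_csSup ?_ ⟨x, y, hx, hy, rfl⟩
  refine ⟨∑ k, ∑ j, |A (Pi.single k 1) (Pi.single j 1)|, ?_⟩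
  rintro t ⟨x, y, hx, hy, rfl⟩
  rw [bilin_expand]
  refine (Finset.abs_sum_le_sum_abs _ _).trans (Finset.sum_le_sum fun k _ => ?_)
  refine (Finset.abs_sum_le_sum_abs _ _).trans (Finset.sum_le_sum fun j _ => ?_)
  rw [abs_mul, abs_mul]
  have : |x k| * |y j| ≤ 1 := mul_le_one₀ (hx k) (abs_nonneg _) (hy j)
  exact mul_le_of_le_one_left (abs_nonneg _) this

theorem real_anisotropic_littlewood (a b : ℝ) (ha : 1 ≤ a) (hb : 1 ≤ b)
    (hab : 1 / a + 1 / b ≤ 3 / 2) (N : ℕ) (hN : 0 < N)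
    (A : (Fin N → ℝ) →ₗ[ℝ] (Fin N → ℝ) →ₗ[ℝ] ℝ) :
    (∑ k : Fin N, (∑ j : Fin N, |A (Pi.single k 1) (Pi.single j 1)| ^ a) ^ (b / a)) ^ (1 / b)
      ≤ (2 : ℝ) ^ (max 0 (1 / a + 1 / b - 1)) * bilinNorm N A := by
  have hA := mbound_bilinNorm A
  have hC := hA.nonneg
  have hb0 : 0 < b := by linarith
  have hT : 0 ≤ ∑ k : Fin N,
      (∑ j : Fin N, |A (Pi.single k 1) (Pi.single j 1)| ^ a) ^ (b / a) :=
    Finset.sum_nonneg fun k _ => Real.rpow_nonneg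
      (Finset.sum_nonneg fun j _ => Real.rpow_nonneg (abs_nonneg _) _) _
  have fin : ∀ D : ℝ, 0 ≤ D → ∑ k : Fin N,
      (∑ j : Fin N, |A (Pi.single k 1) (Pi.single j 1)| ^ a) ^ (b / a) ≤ D ^ b →
      (∑ k : Fin N, (∑ j : Fin N, |A (Pi.single k 1) (Pi.single j 1)| ^ a) ^ (b / a)) ^ (1 / b)
        ≤ D := by
    intro D hD h
    refine (Real.rpow_le_rpow hT h (by positivity)).trans (le_of_eq ?_)
    rw [← Real.rpow_mul hD, mul_one_div_cancel hb0.ne', Real.rpow_one]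
  rcases le_or_gt (1 / a + 1 / b) 1 with h1 | h1
  · rw [max_eq_left (by linarith), Real.rpow_zero, one_mul]
    exact fin _ hC (hA.case_low a b ha hb h1)
  · rw [max_eq_right (by linarith)]
    have hu : 0 < 1 / a + 1 / b - 1 := by linarith
    have key := hA.case_high a b (1 / (1 / a + 1 / b - 1)) ha hb
      (by rw [le_div_iff₀ hu]; linarith) (by rw [one_div_one_div]; ring)
    rw [one_div_one_div] at key
    exact fin _ (mul_nonneg (by positivity) hC) key
end

section
/- Let a, b ∈ [1, ∞) be real numbers. The bilinear form A₀ : ℝ² × ℝ² → ℝ defined by A₀(x, y) = x₁y₁ + x₁y₂ + x₂y₁ − x₂y₂ satisfies ‖A₀‖ = 2 and (∑_{k=1}^2 (∑_{j=1}^2 |A₀(e_k, e_j)|^a)^{b/a})^{1/b} = 2^{1/a + 1/b} = 2^{1/a + 1/b − 1} · ‖A₀‖. Consequently, no constant smaller than 2^{1/a + 1/b − 1} can serve in the real anisotropic Littlewood inequality with exponents (a, b). -/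
open Finset

/-- The bilinear form `A₀(x, y) = x₁y₁ + x₁y₂ + x₂y₁ − x₂y₂` on `ℝ² × ℝ²`. -/
noncomputable def A0 : (Fin 2 → ℝ) →ₗ[ℝ] (Fin 2 → ℝ) →ₗ[ℝ] ℝ :=
  LinearMap.mk₂ ℝ (fun x y => x 0 * y 0 + x 0 * y 1 + x 1 * y 0 - x 1 * y 1)
    (by intros m₁ m₂ n; simp only [Pi.add_apply]; ring)
    (by intros c m n; simp only [Pi.smul_apply, smul_eq_mul]; ring)
    (by intros m n₁ n₂; simp only [Pi.add_apply]; ring)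
    (by intros c m n; simp only [Pi.smul_apply, smul_eq_mul]; ring)

theorem A0_apply_aux (x y : Fin 2 → ℝ) :
    A0 x y = x 0 * y 0 + x 0 * y 1 + x 1 * y 0 - x 1 * y 1 := rfl

theorem A0_norm_aux : bilinNorm 2 A0 = 2 := by
  unfold bilinNorm
  apply IsGreatest.csSup_eq
  constructor
  · refine ⟨fun _ => 1, fun _ => 1, by simp, by simp, ?_⟩
    rw [A0_apply_aux]
    norm_num
  · rintro t ⟨x, y, hx, hy, rfl⟩
    rw [A0_apply_aux]
    have e : x 0 * y 0 + x 0 * y 1 + x 1 * y 0 - x 1 * y 1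
        = x 0 * (y 0 + y 1) + x 1 * (y 0 - y 1) := by ring
    have h1 : |x 0 * (y 0 + y 1)| ≤ |y 0 + y 1| := by
      rw [abs_mul]
      exact mul_le_of_le_one_left (abs_nonneg _) (hx 0)
    have h2 : |x 1 * (y 0 - y 1)| ≤ |y 0 - y 1| := by
      rw [abs_mul]
      exact mul_le_of_le_one_left (abs_nonneg _) (hx 1)
    have h3 : |y 0 + y 1| + |y 0 - y 1| ≤ 2 := by
      have a0 := abs_le.1 (hy 0)
      have a1 := abs_le.1 (hy 1)
      rcases abs_cases (y 0 + y 1) with h | h <;> rcases abs_cases (y 0 - y 1) with h' | h' <;>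
        linarith [h.1, h'.1, a0.1, a0.2, a1.1, a1.2]
    rw [e]
    linarith [abs_add_le (x 0 * (y 0 + y 1)) (x 1 * (y 0 - y 1))]

theorem A0_sum_aux (a b : ℝ) (ha : 1 ≤ a) (hb : 1 ≤ b) :
    (∑ k : Fin 2, (∑ j : Fin 2, |A0 (Pi.single k 1) (Pi.single j 1)| ^ a) ^ (b / a)) ^ (1 / b)
      = (2 : ℝ) ^ (1 / a + 1 / b) := by
  have h : ∀ k j : Fin 2, |A0 (Pi.single k 1) (Pi.single j 1)| = 1 := by
    intro k j
    rw [A0_apply_aux]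
    fin_cases k <;> fin_cases j <;> simp
  simp only [h, Real.one_rpow, Fin.sum_univ_two]
  have e : (1 : ℝ) + 1 = 2 := by norm_num
  rw [e, ← two_mul]
  nth_rewrite 1 [← Real.rpow_one 2]
  rw [← Real.rpow_add two_pos, ← Real.rpow_mul two_pos.le]
  congr 1
  have : a ≠ 0 := by positivity
  have : b ≠ 0 := by positivity
  field_simp
  ring

theorem A0_extremal (a b : ℝ) (ha : 1 ≤ a) (hb : 1 ≤ b) :
    bilinNorm 2 A0 = 2 ∧
    (∑ k : Fin 2, (∑ j : Fin 2, |A0 (Pi.single k 1) (Pi.single j 1)| ^ a) ^ (b / a)) ^ (1 / b)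
      = (2 : ℝ) ^ (1 / a + 1 / b) ∧
    (∑ k : Fin 2, (∑ j : Fin 2, |A0 (Pi.single k 1) (Pi.single j 1)| ^ a) ^ (b / a)) ^ (1 / b)
      = (2 : ℝ) ^ (1 / a + 1 / b - 1) * bilinNorm 2 A0 ∧
    ∀ C : ℝ,
      (∀ N : ℕ, 0 < N → ∀ A : (Fin N → ℝ) →ₗ[ℝ] (Fin N → ℝ) →ₗ[ℝ] ℝ,
        (∑ k : Fin N, (∑ j : Fin N, |A (Pi.single k 1) (Pi.single j 1)| ^ a) ^ (b / a)) ^ (1 / b)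
          ≤ C * bilinNorm N A) →
      (2 : ℝ) ^ (1 / a + 1 / b - 1) ≤ C := by
  have h1 := A0_norm_aux
  have h2 := A0_sum_aux a b ha hb
  have h3 : (2 : ℝ) ^ (1 / a + 1 / b) = (2 : ℝ) ^ (1 / a + 1 / b - 1) * 2 := by
    rw [Real.rpow_sub_one two_ne_zero]
    ring
  refine ⟨h1, h2, by rw [h2, h1, h3], ?_⟩
  intro C hC
  have h := hC 2 two_pos A0
  rw [h2, h1, h3] at h
  linarith
end

section
/- Let a ∈ [2, ∞) be a real number. Then for every positive integer N and every bilinear form A : ℝ^N × ℝ^N → ℝ, one has ∑_{k=1}^N (∑_{j=1}^N |A(e_k, e_j)|^a)^{1/a} ≤ 2^{1/a} · ‖A‖. -/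
open Finset

/-- flip coordinate -/
def cubeFlip {n : ℕ} (i : Fin n) (x : Fin n → Bool) : Fin n → Bool :=
  Function.update x i (!x i)

def cubeNeg {n : ℕ} (x : Fin n → Bool) : Fin n → Bool := fun i => !x i

noncomputable def cubeSgn (b : Bool) : ℝ := if b then 1 else -1

noncomputable def cubeEn {n : ℕ} (f : (Fin n → Bool) → ℝ) : ℝ :=
  ∑ i, ∑ x, (f x - f (cubeFlip i x)) ^ 2

noncomputable def cubeOd {n : ℕ} (f : (Fin n → Bool) → ℝ) : ℝ :=
  ∑ x, (f x - f (cubeNeg x)) ^ 2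

theorem cube_flip_flip {n : ℕ} (i : Fin n) : Function.Involutive (cubeFlip i) := by
  intro x
  simp [cubeFlip]

theorem cube_neg_neg {n : ℕ} : Function.Involutive (cubeNeg (n := n)) := by
  intro x
  funext i
  simp [cubeNeg]

theorem cube_sum_flip {n : ℕ} (i : Fin n) (f : (Fin n → Bool) → ℝ) :
    ∑ x, f (cubeFlip i x) = ∑ x, f x :=
  Equiv.sum_comp (cube_flip_flip i).toPerm f

theorem cube_sum_neg {n : ℕ} (f : (Fin n → Bool) → ℝ) :
    ∑ x, f (cubeNeg x) = ∑ x, f x :=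
  Equiv.sum_comp (cube_neg_neg (n := n)).toPerm f

theorem cube_sum_succ {n : ℕ} (F : (Fin (n + 1) → Bool) → ℝ) :
    ∑ x, F x = ∑ y : Fin n → Bool,
      (F (Fin.cons true y : Fin (n + 1) → Bool) + F (Fin.cons false y : Fin (n + 1) → Bool)) := by
  rw [← Equiv.sum_comp (Fin.consEquiv (fun _ => Bool)) F, Fintype.sum_prod_type]
  simp [Fin.consEquiv, Finset.sum_add_distrib]

theorem cube_flip_zero {n : ℕ} (b : Bool) (y : Fin n → Bool) :
    cubeFlip 0 (Fin.cons b y : Fin (n + 1) → Bool) = (Fin.cons (!b) y : Fin (n + 1) → Bool) := by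
  funext j
  refine Fin.cases ?_ (fun j => ?_) j <;> simp [cubeFlip]

theorem cube_flip_succ {n : ℕ} (b : Bool) (i : Fin n) (y : Fin n → Bool) :
    cubeFlip i.succ (Fin.cons b y : Fin (n + 1) → Bool)
      = (Fin.cons b (cubeFlip i y) : Fin (n + 1) → Bool) := by
  simp [cubeFlip, Fin.cons_update]

theorem cube_neg_cons {n : ℕ} (b : Bool) (y : Fin n → Bool) :
    cubeNeg (Fin.cons b y : Fin (n + 1) → Bool)
      = (Fin.cons (!b) (cubeNeg y) : Fin (n + 1) → Bool) := by
  funext j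
  refine Fin.cases ?_ (fun j => ?_) j <;> simp [cubeNeg]

noncomputable def cubeP {n : ℕ} (f : (Fin (n + 1) → Bool) → ℝ) (y : Fin n → Bool) : ℝ :=
  f (Fin.cons true y : Fin (n + 1) → Bool) + f (Fin.cons false y : Fin (n + 1) → Bool)

noncomputable def cubeM {n : ℕ} (f : (Fin (n + 1) → Bool) → ℝ) (y : Fin n → Bool) : ℝ :=
  f (Fin.cons true y : Fin (n + 1) → Bool) - f (Fin.cons false y : Fin (n + 1) → Bool)

theorem cube_en_succ {n : ℕ} (f : (Fin (n + 1) → Bool) → ℝ) :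
    cubeEn f = cubeEn (cubeP f) / 2 + cubeEn (cubeM f) / 2 + 2 * ∑ y, cubeM f y ^ 2 := by
  unfold cubeEn
  rw [Fin.sum_univ_succ, add_comm]
  congr 1
  · rw [Finset.sum_div, Finset.sum_div, ← Finset.sum_add_distrib]
    refine Finset.sum_congr rfl fun i _ => ?_
    rw [cube_sum_succ, Finset.sum_div, Finset.sum_div, ← Finset.sum_add_distrib]
    refine Finset.sum_congr rfl fun y _ => ?_
    simp only [cube_flip_succ, cubeP, cubeM]
    ring
  · rw [cube_sum_succ, Finset.mul_sum]
    refine Finset.sum_congr rfl fun y _ => ?_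
    simp only [cube_flip_zero, cubeM, Bool.not_true, Bool.not_false]
    ring

theorem cube_od_succ {n : ℕ} (f : (Fin (n + 1) → Bool) → ℝ) :
    cubeOd f = cubeOd (cubeP f) / 2 + 2 * ∑ y, cubeM f y ^ 2 - cubeOd (cubeM f) / 2 := by
  have h : ∑ y, cubeM f y ^ 2
      = (∑ y, (cubeM f y ^ 2 + cubeM f (cubeNeg y) ^ 2)) / 2 := by
    rw [Finset.sum_add_distrib, cube_sum_neg (fun y => cubeM f y ^ 2)]
    ring
  rw [h]
  unfold cubeOd
  rw [cube_sum_succ, Finset.sum_div, Finset.sum_div, Finset.sum_div, Finset.mul_sum,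
    ← Finset.sum_add_distrib, ← Finset.sum_sub_distrib]
  refine Finset.sum_congr rfl fun y _ => ?_
  simp only [cube_neg_cons, cubeP, cubeM, Bool.not_true, Bool.not_false]
  ring

theorem cube_en_nonneg {n : ℕ} (f : (Fin n → Bool) → ℝ) : 0 ≤ cubeEn f :=
  Finset.sum_nonneg fun _ _ => Finset.sum_nonneg fun _ _ => sq_nonneg _

theorem cube_od_nonneg {n : ℕ} (f : (Fin n → Bool) → ℝ) : 0 ≤ cubeOd f :=
  Finset.sum_nonneg fun _ _ => sq_nonneg _

theorem cube_od_le_en : ∀ {n : ℕ} (f : (Fin n → Bool) → ℝ), cubeOd f ≤ cubeEn f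
  | 0, f => by
    have : ∀ x : Fin 0 → Bool, cubeNeg x = x := fun x => Subsingleton.elim _ _
    simp [cubeOd, cubeEn, this]
  | n + 1, f => by
    rw [cube_od_succ, cube_en_succ]
    have := cube_od_le_en (cubeP f)
    have := cube_en_nonneg (cubeM f)
    have := cube_od_nonneg (cubeM f)
    linarith

theorem cube_poincare : ∀ {n : ℕ} (f : (Fin n → Bool) → ℝ),
    8 * (∑ x, f x ^ 2 - (∑ x, f x) ^ 2 / 2 ^ n) ≤ cubeEn f + cubeOd f
  | 0, f => by
    have h1 := cube_en_nonneg f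
    have h2 := cube_od_nonneg f
    have : (∑ x, f x ^ 2 - (∑ x, f x) ^ 2 / 2 ^ 0) = 0 := by simp
    rw [this]
    linarith
  | n + 1, f => by
    rw [cube_od_succ, cube_en_succ]
    have h1 := cube_poincare (cubeP f)
    have h2 := cube_od_le_en (cubeM f)
    have h3 : ∑ x, f x ^ 2 = (∑ y, cubeP f y ^ 2) / 2 + (∑ y, cubeM f y ^ 2) / 2 := by
      rw [cube_sum_succ, Finset.sum_div, Finset.sum_div, ← Finset.sum_add_distrib]
      refine Finset.sum_congr rfl fun y _ => ?_
      simp only [cubeP, cubeM]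
      ring
    have h4 : ∑ x, f x = ∑ y, cubeP f y := cube_sum_succ f
    have h5 : (∑ y, cubeP f y) ^ 2 / 2 ^ (n + 1) = (∑ y, cubeP f y) ^ 2 / 2 ^ n / 2 := by
      rw [pow_succ (2 : ℝ) n, div_div]
    rw [h3, h4, h5]
    linarith

noncomputable def cubeS {n : ℕ} (v : Fin n → ℝ) (x : Fin n → Bool) : ℝ :=
  ∑ j, cubeSgn (x j) * v j

theorem cube_sgn_not (b : Bool) : cubeSgn (!b) = - cubeSgn b := by
  cases b <;> simp [cubeSgn]

theorem cube_sgn_abs (b : Bool) : |cubeSgn b| = 1 := by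
  cases b <;> simp [cubeSgn]

theorem cubeS_flip {n : ℕ} (v : Fin n → ℝ) (i : Fin n) (x : Fin n → Bool) :
    cubeS v (cubeFlip i x) = cubeS v x - 2 * (cubeSgn (x i) * v i) := by
  unfold cubeS
  rw [← Finset.add_sum_erase _ _ (Finset.mem_univ i),
    ← Finset.add_sum_erase (a := i) _ (fun j => cubeSgn (x j) * v j) (Finset.mem_univ i)]
  have : ∑ j ∈ univ.erase i, cubeSgn (cubeFlip i x j) * v j
      = ∑ j ∈ univ.erase i, cubeSgn (x j) * v j := by
    refine Finset.sum_congr rfl fun j hj => ?_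
    simp [cubeFlip, Function.update_of_ne (Finset.ne_of_mem_erase hj)]
  rw [this]
  simp only [cubeFlip, Function.update_self, cube_sgn_not]
  ring

theorem cubeS_neg {n : ℕ} (v : Fin n → ℝ) (x : Fin n → Bool) :
    cubeS v (cubeNeg x) = - cubeS v x := by
  simp [cubeS, cubeNeg, cube_sgn_not]

theorem cubeS_sq : ∀ {n : ℕ} (v : Fin n → ℝ),
    ∑ x, cubeS v x ^ 2 = 2 ^ n * ∑ j, v j ^ 2
  | 0, v => by simp [cubeS]
  | n + 1, v => by
    have ih := cubeS_sq (fun j : Fin n => v j.succ)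
    rw [cube_sum_succ, Fin.sum_univ_succ]
    have : ∀ y : Fin n → Bool,
        cubeS v (Fin.cons true y : Fin (n + 1) → Bool) ^ 2
          + cubeS v (Fin.cons false y : Fin (n + 1) → Bool) ^ 2
        = 2 * v 0 ^ 2 + 2 * cubeS (fun j : Fin n => v j.succ) y ^ 2 := by
      intro y
      simp only [cubeS, Fin.sum_univ_succ, Fin.cons_zero, Fin.cons_succ]
      simp only [cubeSgn]
      simp
      ring
    simp only [this]
    rw [Finset.sum_add_distrib, ← Finset.mul_sum, ← Finset.mul_sum, ih]
    simp
    ring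

theorem cube_khinchine {n : ℕ} (v : Fin n → ℝ) :
    ∑ j, v j ^ 2 ≤ 2 * ((∑ x, |cubeS v x|) / 2 ^ n) ^ 2 := by
  set f : (Fin n → Bool) → ℝ := fun x => |cubeS v x| with hf
  have hP := cube_poincare f
  have hO : cubeOd f = 0 := by simp [cubeOd, hf, cubeS_neg]
  have hE : cubeEn f ≤ 4 * ∑ x, f x ^ 2 := by
    have e1 : cubeEn f = ∑ x, 2 * (f x * ∑ i, (f x - f (cubeFlip i x))) := by
      have : ∀ i, ∑ x, (f x - f (cubeFlip i x)) ^ 2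
          = ∑ x, 2 * (f x * (f x - f (cubeFlip i x))) := by
        intro i
        have h := cube_sum_flip i (fun x => f x ^ 2)
        have : ∀ x, (f x - f (cubeFlip i x)) ^ 2
          = 2 * (f x * (f x - f (cubeFlip i x))) + (f (cubeFlip i x) ^ 2 - f x ^ 2) := by
          intro x; ring
        simp only [this]
        rw [Finset.sum_add_distrib, Finset.sum_sub_distrib, h]
        ring
      unfold cubeEn
      simp only [this]
      rw [Finset.sum_comm]
      simp only [Finset.mul_sum]
    rw [e1, Finset.mul_sum]
    refine Finset.sum_le_sum fun x _ => ?_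
    have h0 : 0 ≤ f x := abs_nonneg _
    have h1 : ∑ i, (f x - f (cubeFlip i x)) ≤ 2 * f x := by
      rw [Finset.sum_sub_distrib]
      have h2 : ((n : ℝ) - 2) * cubeS v x = ∑ i, cubeS v (cubeFlip i x) := by
        simp only [cubeS_flip]
        rw [Finset.sum_sub_distrib, ← Finset.mul_sum]
        simp only [Finset.sum_const, Finset.card_univ, Fintype.card_fin, nsmul_eq_mul]
        unfold cubeS
        ring
      have h3 : |((n : ℝ) - 2) * cubeS v x| ≤ ∑ i, f (cubeFlip i x) := by
        rw [h2]; exact Finset.abs_sum_le_sum_abs _ _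
      rw [abs_mul] at h3
      have h4 : ((n : ℝ) - 2) * f x ≤ |(n : ℝ) - 2| * |cubeS v x| :=
        mul_le_mul_of_nonneg_right (le_abs_self _) h0
      simp only [Finset.sum_const, Finset.card_univ, Fintype.card_fin, nsmul_eq_mul]
      linarith
    nlinarith [mul_le_mul_of_nonneg_left h1 h0]
  have hS : ∑ x, f x ^ 2 = 2 ^ n * ∑ j, v j ^ 2 := by
    rw [← cubeS_sq]; simp [hf]
  have hpos : (0 : ℝ) < 2 ^ n := by positivity
  have key : 2 ^ n * ∑ j, v j ^ 2 ≤ 2 * ((∑ x, f x) ^ 2 / 2 ^ n) := by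
    rw [← hS]; linarith
  have e : 2 * ((∑ x, f x) ^ 2 / 2 ^ n) = 2 ^ n * (2 * ((∑ x, f x) / 2 ^ n) ^ 2) := by
    field_simp
  rw [e] at key
  exact le_of_mul_le_mul_left key hpos

theorem cube_sup_le {n : ℕ} (v : Fin n → ℝ) (j : Fin n) :
    |v j| ≤ (∑ x, |cubeS v x|) / 2 ^ n := by
  rw [le_div_iff₀ (by positivity)]
  have h1 := cube_sum_flip j (fun x => |cubeS v x|)
  have h2 : ∑ _x : Fin n → Bool, 2 * |v j| ≤ ∑ x, (|cubeS v x| + |cubeS v (cubeFlip j x)|) := by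
    refine Finset.sum_le_sum fun x _ => ?_
    have h := abs_sub (cubeS v x) (cubeS v (cubeFlip j x))
    have e : cubeS v x - cubeS v (cubeFlip j x) = 2 * (cubeSgn (x j) * v j) := by
      rw [cubeS_flip]; ring
    rw [e, abs_mul, abs_mul, cube_sgn_abs] at h
    simpa using h
  rw [Finset.sum_add_distrib, h1] at h2
  simp at h2
  linarith

theorem cube_row {n : ℕ} (a : ℝ) (ha : 2 ≤ a) (v : Fin n → ℝ) :
    (∑ j, |v j| ^ a) ^ (1 / a) ≤ 2 ^ (1 / a) * ((∑ x, |cubeS v x|) / 2 ^ n) := by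
  have hK := cube_khinchine v
  have hM := cube_sup_le v
  set M := (∑ x, |cubeS v x|) / 2 ^ n with hMdef
  have hM0 : 0 ≤ M := by positivity
  have hpow : ∀ t : ℝ, 0 ≤ t → t ^ a = t ^ 2 * t ^ (a - 2) := by
    intro t ht
    rw [← Real.rpow_natCast t 2, ← Real.rpow_add_of_nonneg ht (by norm_num) (by linarith)]
    congr 1
    push_cast
    ring
  have h1 : ∑ j, |v j| ^ a ≤ 2 * M ^ a := by
    calc ∑ j, |v j| ^ a ≤ ∑ j, v j ^ 2 * M ^ (a - 2) := by
          refine Finset.sum_le_sum fun j _ => ?_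
          rw [hpow _ (abs_nonneg _), sq_abs]
          exact mul_le_mul_of_nonneg_left
            (Real.rpow_le_rpow (abs_nonneg _) (hM j) (by linarith)) (sq_nonneg _)
      _ = (∑ j, v j ^ 2) * M ^ (a - 2) := by rw [Finset.sum_mul]
      _ ≤ (2 * M ^ 2) * M ^ (a - 2) :=
          mul_le_mul_of_nonneg_right hK (Real.rpow_nonneg hM0 _)
      _ = 2 * M ^ a := by rw [hpow M hM0]; ring
  calc (∑ j, |v j| ^ a) ^ (1 / a) ≤ (2 * M ^ a) ^ (1 / a) :=
        Real.rpow_le_rpow (Finset.sum_nonneg fun j _ => Real.rpow_nonneg (abs_nonneg _) _) h1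
          (by positivity)
    _ = 2 ^ (1 / a) * M := by
        rw [Real.mul_rpow (by norm_num) (Real.rpow_nonneg hM0 _), ← Real.rpow_mul hM0,
          mul_one_div_cancel (by linarith), Real.rpow_one]

theorem cube_vec_sum {N : ℕ} (x : Fin N → ℝ) : x = ∑ i, x i • (Pi.single i 1 : Fin N → ℝ) := by
  funext j
  simp [Finset.sum_apply, Pi.single_apply]

theorem bilin_le_norm (N : ℕ) (A : (Fin N → ℝ) →ₗ[ℝ] (Fin N → ℝ) →ₗ[ℝ] ℝ)
    (x y : Fin N → ℝ) (hx : ∀ i, |x i| ≤ 1) (hy : ∀ j, |y j| ≤ 1) :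
    |A x y| ≤ bilinNorm N A := by
  refine le_csSup ⟨∑ i, ∑ j, |A (Pi.single i 1) (Pi.single j 1)|, ?_⟩ ⟨x, y, hx, hy, rfl⟩
  rintro t ⟨x, y, hx, hy, rfl⟩
  have e : A x y = ∑ i, ∑ j, x i * (y j * A (Pi.single i 1) (Pi.single j 1)) := by
    conv_lhs => rw [cube_vec_sum x, cube_vec_sum y]
    simp only [map_sum, LinearMap.sum_apply, map_smul, LinearMap.smul_apply, smul_eq_mul,
      Finset.mul_sum]
    rw [Finset.sum_comm]
    refine Finset.sum_congr rfl fun i _ => Finset.sum_congr rfl fun j _ => by ring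
  rw [e]
  refine (Finset.abs_sum_le_sum_abs _ _).trans (Finset.sum_le_sum fun i _ => ?_)
  refine (Finset.abs_sum_le_sum_abs _ _).trans (Finset.sum_le_sum fun j _ => ?_)
  rw [abs_mul, abs_mul]
  have h0 := abs_nonneg (A (Pi.single i 1) (Pi.single j 1))
  have h1 : |y j| * |A (Pi.single i 1) (Pi.single j 1)| ≤ |A (Pi.single i 1) (Pi.single j 1)| :=
    mul_le_of_le_one_left h0 (hy j)
  exact (mul_le_of_le_one_left (by positivity) (hx i)).trans h1

theorem bilin_rows (N : ℕ) (A : (Fin N → ℝ) →ₗ[ℝ] (Fin N → ℝ) →ₗ[ℝ] ℝ) (x : Fin N → Bool) :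
    ∑ k, |cubeS (fun j => A (Pi.single k 1) (Pi.single j 1)) x| ≤ bilinNorm N A := by
  set y : Fin N → ℝ := fun j => cubeSgn (x j) with hy
  have e : ∀ k, cubeS (fun j => A (Pi.single k 1) (Pi.single j 1)) x = A (Pi.single k 1) y := by
    intro k
    conv_rhs => rw [cube_vec_sum y]
    simp [cubeS, hy]
  simp only [e]
  set u : Fin N → ℝ := fun k => if 0 ≤ A (Pi.single k 1) y then 1 else -1 with hu
  have h := bilin_le_norm N A u y
    (fun i => by simp only [hu]; split_ifs <;> simp) (fun j => (cube_sgn_abs _).le)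
  refine le_trans (le_of_eq ?_) ((le_abs_self _).trans h)
  conv_rhs => rw [cube_vec_sum u]
  simp only [map_sum, LinearMap.sum_apply, map_smul, LinearMap.smul_apply, smul_eq_mul]
  refine Finset.sum_congr rfl fun k _ => ?_
  simp only [hu]
  split_ifs with h0
  · rw [abs_of_nonneg h0, one_mul]
  · rw [abs_of_neg (not_le.mp h0)]; ring

theorem real_mixed_one_a (a : ℝ) (ha : 2 ≤ a) (N : ℕ) (hN : 0 < N)
    (A : (Fin N → ℝ) →ₗ[ℝ] (Fin N → ℝ) →ₗ[ℝ] ℝ) :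
    ∑ k : Fin N, (∑ j : Fin N, |A (Pi.single k 1) (Pi.single j 1)| ^ a) ^ (1 / a)
      ≤ (2 : ℝ) ^ (1 / a) * bilinNorm N A := by
  refine (Finset.sum_le_sum fun k _ =>
    cube_row a ha (fun j => A (Pi.single k 1) (Pi.single j 1))).trans ?_
  rw [← Finset.mul_sum]
  refine mul_le_mul_of_nonneg_left ?_ (by positivity)
  rw [← Finset.sum_div, Finset.sum_comm, div_le_iff₀ (by positivity)]
  refine (Finset.sum_le_sum fun x _ => bilin_rows N A x).trans (le_of_eq ?_)
  simp
  ring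
end

section
/- For every positive integer N and every bilinear form A : ℝ^N × ℝ^N → ℝ, one has ∑_{k=1}^N max_{1 ≤ j ≤ N} |A(e_k, e_j)| ≤ ‖A‖. -/
open Finset

lemma lin_expand {N : ℕ} {M : Type*} [AddCommGroup M] [Module ℝ M] (f : (Fin N → ℝ) →ₗ[ℝ] M)
    (x : Fin N → ℝ) : f x = ∑ i, x i • f (Pi.single i 1) := by
  conv_lhs => rw [pi_eq_sum_univ' x]
  rw [map_sum]
  refine Finset.sum_congr rfl fun i _ => ?_
  rw [map_smul]

lemma bdd_aux (N : ℕ) (A : (Fin N → ℝ) →ₗ[ℝ] (Fin N → ℝ) →ₗ[ℝ] ℝ) :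
    BddAbove { t : ℝ | ∃ x y : Fin N → ℝ, (∀ i, |x i| ≤ 1) ∧ (∀ j, |y j| ≤ 1) ∧ t = |A x y| } := by
  refine ⟨∑ i, ∑ j, |A (Pi.single i 1) (Pi.single j 1)|, ?_⟩
  rintro t ⟨x, y, hx, hy, rfl⟩
  rw [lin_expand A x, LinearMap.sum_apply]
  refine (Finset.abs_sum_le_sum_abs _ _).trans (Finset.sum_le_sum fun i _ => ?_)
  rw [LinearMap.smul_apply, smul_eq_mul, abs_mul]
  refine (mul_le_of_le_one_left (abs_nonneg _) (hx i)).trans ?_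
  rw [lin_expand (A (Pi.single i 1)) y]
  refine (Finset.abs_sum_le_sum_abs _ _).trans (Finset.sum_le_sum fun j _ => ?_)
  rw [smul_eq_mul, abs_mul]
  exact mul_le_of_le_one_left (abs_nonneg _) (hy j)

/-- The sign vector attached to a Boolean vector. -/
def sgnVec {N : ℕ} (b : Fin N → Bool) : Fin N → ℝ := fun i => if b i then 1 else -1

lemma sgnVec_abs {N : ℕ} (b : Fin N → Bool) (i : Fin N) : |sgnVec b i| = 1 := by
  unfold sgnVec; split_ifs <;> simp

/-- Flip all coordinates except `j`. -/
def flipOff {N : ℕ} (j : Fin N) (b : Fin N → Bool) : Fin N → Bool :=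
  fun i => if i = j then b i else !(b i)

lemma flipOff_invol {N : ℕ} (j : Fin N) : Function.Involutive (flipOff j) := by
  intro b; ext i; unfold flipOff; split_ifs <;> simp

lemma flip_add {N : ℕ} (j : Fin N) (b : Fin N → Bool) :
    sgnVec b + sgnVec (flipOff j b) = (2 * sgnVec b j) • (Pi.single j 1 : Fin N → ℝ) := by
  ext i
  by_cases h : i = j
  · subst h; cases hb : b i <;> simp [sgnVec, flipOff, hb] <;> norm_num
  · cases hb : b i <;> simp [sgnVec, flipOff, h, hb]

lemma avg_aux {N : ℕ} (f : (Fin N → ℝ) →ₗ[ℝ] ℝ) (j : Fin N) :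
    ∑ _b : Fin N → Bool, |f (Pi.single j 1)| ≤ ∑ b : Fin N → Bool, |f (sgnVec b)| := by
  have h1 : ∑ b : Fin N → Bool, |f (sgnVec (flipOff j b))| = ∑ b, |f (sgnVec b)| :=
    Equiv.sum_comp (flipOff_invol j).toPerm (fun b => |f (sgnVec b)|)
  have h2 : ∑ _b : Fin N → Bool, 2 * |f (Pi.single j 1)| ≤
      ∑ b : Fin N → Bool, (|f (sgnVec b)| + |f (sgnVec (flipOff j b))|) := by
    refine Finset.sum_le_sum fun b _ => ?_
    refine le_trans (le_of_eq ?_) (abs_add_le _ _)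
    rw [← map_add, flip_add, map_smul, smul_eq_mul, abs_mul, abs_mul, sgnVec_abs]
    simp
  rw [← Finset.mul_sum, Finset.sum_add_distrib, h1] at h2
  linarith

theorem real_sum_of_row_maxima (N : ℕ) (hN : 0 < N)
    (A : (Fin N → ℝ) →ₗ[ℝ] (Fin N → ℝ) →ₗ[ℝ] ℝ) :
    ∑ k : Fin N,
        Finset.univ.sup' (Finset.univ_nonempty_iff.mpr (Fin.pos_iff_nonempty.mp hN))
          (fun j => |A (Pi.single k 1) (Pi.single j 1)|)
      ≤ bilinNorm N A := by
  have hne := Finset.univ_nonempty_iff.mpr (Fin.pos_iff_nonempty.mp hN)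
  have hj : ∀ k : Fin N, ∃ j : Fin N,
      Finset.univ.sup' hne (fun j => |A (Pi.single k 1) (Pi.single j 1)|)
        = |A (Pi.single k 1) (Pi.single j 1)| := fun k => by
    obtain ⟨j, -, h⟩ := Finset.exists_mem_eq_sup' hne
      (fun j => |A (Pi.single k 1) (Pi.single j 1)|)
    exact ⟨j, h⟩
  choose J hJ using hj
  rw [Finset.sum_congr rfl fun k _ => hJ k]
  have key : ∑ _b : Fin N → Bool, ∑ k, |A (Pi.single k 1) (Pi.single (J k) 1)| ≤
      ∑ b : Fin N → Bool, ∑ k, |A (Pi.single k 1) (sgnVec b)| := by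
    rw [Finset.sum_comm, Finset.sum_comm (s := (Finset.univ : Finset (Fin N → Bool)))]
    exact Finset.sum_le_sum fun k _ => avg_aux _ _
  obtain ⟨b, -, hb⟩ := Finset.exists_le_of_sum_le Finset.univ_nonempty key
  refine hb.trans (le_csSup (bdd_aux N A) ?_)
  refine ⟨fun k => (SignType.sign (A (Pi.single k 1) (sgnVec b)) : ℝ), sgnVec b, fun i => ?_,
    fun j => (sgnVec_abs b j).le, ?_⟩
  · rcases lt_trichotomy (A (Pi.single i 1) (sgnVec b)) 0 with h | h | h <;> simp [h]
  · rw [lin_expand A (fun k => _), LinearMap.sum_apply]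
    simp only [LinearMap.smul_apply, smul_eq_mul, sign_mul_self]
    rw [abs_of_nonneg (Finset.sum_nonneg fun _ _ => abs_nonneg _)]
end

section
/- For every positive integer N and every bilinear form A : ℝ^N × ℝ^N → ℝ, one has (∑_{i=1}^N ∑_{j=1}^N |A(e_i, e_j)|^{4/3})^{3/4} ≤ √2 · ‖A‖ (Littlewood's 4/3 inequality with the optimal real constant √2). -/
open Finset

/-- Expectation over random signs. -/
noncomputable def lwE : (n : ℕ) → ((Fin n → ℝ) → ℝ) → ℝ
  | 0, f => f (fun _ => 1)
  | n + 1, f => (lwE n (fun x => f (Fin.cons 1 x)) + lwE n (fun x => f (Fin.cons (-1) x))) / 2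

theorem lwE_succ (n : ℕ) (f : (Fin (n + 1) → ℝ) → ℝ) :
    lwE (n + 1) f
      = (lwE n (fun x => f (Fin.cons 1 x)) + lwE n (fun x => f (Fin.cons (-1) x))) / 2 := rfl

theorem lwE_add (n : ℕ) (f g : (Fin n → ℝ) → ℝ) :
    lwE n (fun x => f x + g x) = lwE n f + lwE n g := by
  induction n with
  | zero => rfl
  | succ n ih => simp only [lwE_succ, ih]; ring

theorem lwE_mul (n : ℕ) (c : ℝ) (f : (Fin n → ℝ) → ℝ) :
    lwE n (fun x => c * f x) = c * lwE n f := by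
  induction n with
  | zero => rfl
  | succ n ih => simp only [lwE_succ, ih]; ring

theorem lwE_const (n : ℕ) (c : ℝ) : lwE n (fun _ => c) = c := by
  induction n with
  | zero => rfl
  | succ n ih => simp only [lwE_succ, ih]; ring

theorem lwE_sum {ι : Type*} (s : Finset ι) (n : ℕ) (f : ι → (Fin n → ℝ) → ℝ) :
    lwE n (fun x => ∑ i ∈ s, f i x) = ∑ i ∈ s, lwE n (f i) := by
  classical
  induction s using Finset.induction_on with
  | empty => simp [lwE_const]
  | insert a s ha ih => simp only [Finset.sum_insert ha, lwE_add, ih]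

theorem lwE_mono (n : ℕ) (f g : (Fin n → ℝ) → ℝ)
    (h : ∀ x, (∀ i, |x i| ≤ 1) → f x ≤ g x) : lwE n f ≤ lwE n g := by
  induction n with
  | zero => exact h _ (by simp)
  | succ n ih =>
    simp only [lwE_succ]
    have h1 := ih (fun x => f (Fin.cons 1 x)) (fun x => g (Fin.cons 1 x)) (by
      intro x hx
      apply h
      intro i
      refine Fin.cases ?_ ?_ i <;> simp [hx])
    have h2 := ih (fun x => f (Fin.cons (-1) x)) (fun x => g (Fin.cons (-1) x)) (by
      intro x hx
      apply h
      intro i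
      refine Fin.cases ?_ ?_ i <;> simp [hx])
    linarith

theorem lwE_neg (n : ℕ) (f : (Fin n → ℝ) → ℝ) : lwE n (fun x => f (-x)) = lwE n f := by
  induction n with
  | zero =>
    show f _ = f _
    congr 1
    exact Subsingleton.elim _ _
  | succ n ih =>
    have key : ∀ (c : ℝ) (x : Fin n → ℝ),
        (-(Fin.cons c x : Fin (n + 1) → ℝ)) = Fin.cons (-c) (-x) := by
      intro c x
      funext i
      refine Fin.cases ?_ ?_ i <;> simp
    simp only [lwE_succ, key, neg_neg]
    rw [ih (fun x => f (Fin.cons (-1) x)), ih (fun x => f (Fin.cons 1 x))]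
    ring

/-- Jensen. -/
theorem lwE_sq (n : ℕ) (f : (Fin n → ℝ) → ℝ) : (lwE n f) ^ 2 ≤ lwE n (fun x => f x * f x) := by
  induction n with
  | zero => show (f _) ^ 2 ≤ f _ * f _; rw [sq]
  | succ n ih =>
    simp only [lwE_succ]
    have h1 := ih (fun x => f (Fin.cons 1 x))
    have h2 := ih (fun x => f (Fin.cons (-1) x))
    nlinarith [sq_nonneg (lwE n (fun x => f (Fin.cons 1 x)) - lwE n (fun x => f (Fin.cons (-1) x)))]

/-- The generator (number operator). -/
noncomputable def lwL (n : ℕ) (f : (Fin n → ℝ) → ℝ) (x : Fin n → ℝ) : ℝ :=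
  ∑ k, (f x - f (Function.update x k (-x k))) / 2

theorem lwL_cons (n : ℕ) (f : (Fin (n + 1) → ℝ) → ℝ) (c : ℝ) (x : Fin n → ℝ) :
    lwL (n + 1) f (Fin.cons c x)
      = (f (Fin.cons c x) - f (Fin.cons (-c) x)) / 2 + lwL n (fun y => f (Fin.cons c y)) x := by
  unfold lwL
  rw [Fin.sum_univ_succ]
  simp [Fin.cons_update]

theorem lwL_lin (n : ℕ) (a b : ℝ) (f g : (Fin n → ℝ) → ℝ) (x : Fin n → ℝ) :
    lwL n (fun y => a * f y + b * g y) x = a * lwL n f x + b * lwL n g x := by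
  unfold lwL
  rw [Finset.mul_sum, Finset.mul_sum, ← Finset.sum_add_distrib]
  refine Finset.sum_congr rfl fun k _ => ?_
  ring

/-- Dirichlet form, split along the first coordinate. -/
theorem lwB_succ (n : ℕ) (f : (Fin (n + 1) → ℝ) → ℝ) (u v : (Fin n → ℝ) → ℝ)
    (hu : u = fun x => (1 / 2) * f (Fin.cons 1 x) + (1 / 2) * f (Fin.cons (-1) x))
    (hv : v = fun x => (1 / 2) * f (Fin.cons 1 x) + (-1 / 2) * f (Fin.cons (-1) x)) :
    lwE (n + 1) (fun x => f x * lwL (n + 1) f x)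
      = lwE n (fun x => u x * lwL n u x) + lwE n (fun x => v x * lwL n v x)
        + lwE n (fun x => v x * v x) := by
  rw [lwE_succ, ← lwE_add, ← lwE_add, ← lwE_add, div_eq_inv_mul, ← lwE_mul]
  congr 1
  funext x
  rw [lwL_cons, lwL_cons, hu, hv, lwL_lin, lwL_lin]
  simp only [neg_neg]
  ring

theorem lwSq_succ (n : ℕ) (f : (Fin (n + 1) → ℝ) → ℝ) (u v : (Fin n → ℝ) → ℝ)
    (hu : u = fun x => (1 / 2) * f (Fin.cons 1 x) + (1 / 2) * f (Fin.cons (-1) x))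
    (hv : v = fun x => (1 / 2) * f (Fin.cons 1 x) + (-1 / 2) * f (Fin.cons (-1) x)) :
    lwE (n + 1) (fun x => f x * f x)
      = lwE n (fun x => u x * u x) + lwE n (fun x => v x * v x) := by
  rw [lwE_succ, ← lwE_add, ← lwE_add, div_eq_inv_mul, ← lwE_mul]
  congr 1
  funext x
  rw [hu, hv]
  ring

theorem lwE_succ' (n : ℕ) (f : (Fin (n + 1) → ℝ) → ℝ) (u : (Fin n → ℝ) → ℝ)
    (hu : u = fun x => (1 / 2) * f (Fin.cons 1 x) + (1 / 2) * f (Fin.cons (-1) x)) :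
    lwE (n + 1) f = lwE n u := by
  rw [lwE_succ, ← lwE_add, div_eq_inv_mul, ← lwE_mul]
  congr 1
  funext x
  rw [hu]
  ring

theorem lw_poincare (n : ℕ) (f : (Fin n → ℝ) → ℝ) :
    lwE n (fun x => f x * f x) - (lwE n f) ^ 2 ≤ lwE n (fun x => f x * lwL n f x) := by
  induction n with
  | zero => simp [lwE, lwL, sq]
  | succ n ih =>
    obtain ⟨u, hu⟩ : ∃ u : (Fin n → ℝ) → ℝ, u =
      fun x => (1 / 2) * f (Fin.cons 1 x) + (1 / 2) * f (Fin.cons (-1) x) := ⟨_, rfl⟩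
    obtain ⟨v, hv⟩ : ∃ v : (Fin n → ℝ) → ℝ, v =
      fun x => (1 / 2) * f (Fin.cons 1 x) + (-1 / 2) * f (Fin.cons (-1) x) := ⟨_, rfl⟩
    rw [lwB_succ n f u v hu hv, lwSq_succ n f u v hu hv, lwE_succ' n f u hu]
    have := ih u
    have := ih v
    have := lwE_sq n v
    linarith

theorem lw_poincare2 (n : ℕ) (f : (Fin n → ℝ) → ℝ) :
    2 * (lwE n (fun x => f x * f x) - (lwE n f) ^ 2) ≤ lwE n (fun x => f x * lwL n f x)
      + ∑ i, (lwE n (fun x => f x * x i)) ^ 2 := by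
  induction n with
  | zero => simp [lwE, lwL, sq]
  | succ n ih =>
    obtain ⟨u, hu⟩ : ∃ u : (Fin n → ℝ) → ℝ, u =
      fun x => (1 / 2) * f (Fin.cons 1 x) + (1 / 2) * f (Fin.cons (-1) x) := ⟨_, rfl⟩
    obtain ⟨v, hv⟩ : ∃ v : (Fin n → ℝ) → ℝ, v =
      fun x => (1 / 2) * f (Fin.cons 1 x) + (-1 / 2) * f (Fin.cons (-1) x) := ⟨_, rfl⟩
    rw [lwB_succ n f u v hu hv, lwSq_succ n f u v hu hv, lwE_succ' n f u hu, Fin.sum_univ_succ]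
    have h0 : lwE (n + 1) (fun x => f x * x 0) = lwE n v := by
      apply lwE_succ'
      funext x
      simp [hv]
      ring
    have hs : ∀ i : Fin n, lwE (n + 1) (fun x => f x * x i.succ) = lwE n (fun x => u x * x i) := by
      intro i
      apply lwE_succ'
      funext x
      simp [hu]
      ring
    simp only [h0, hs]
    have := ih u
    have := lw_poincare n v
    linarith

theorem lw_second_moment (n : ℕ) (a : Fin n → ℝ) (c : ℝ) :
    lwE n (fun x => (c + ∑ i, a i * x i) * (c + ∑ i, a i * x i)) = c ^ 2 + ∑ i, a i ^ 2 := by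
  induction n generalizing c with
  | zero => simp [lwE, sq]
  | succ n ih =>
    have h1 := ih (fun i => a i.succ) (c + a 0)
    have h2 := ih (fun i => a i.succ) (c - a 0)
    rw [lwE_succ]
    simp only [Fin.sum_univ_succ, Fin.cons_zero, Fin.cons_succ, mul_one, mul_neg, ← add_assoc,
      ← sub_eq_add_neg]
    rw [h1, h2]
    ring

/-- Khinchine's inequality with the optimal constant. -/
theorem lw_khinchine (n : ℕ) (a : Fin n → ℝ) :
    Real.sqrt (∑ i, a i ^ 2) ≤ Real.sqrt 2 * lwE n (fun x => |∑ i, a i * x i|) := by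
  set f : (Fin n → ℝ) → ℝ := fun x => |∑ i, a i * x i| with hf
  have hnn : 0 ≤ lwE n f := by
    rw [← lwE_const n 0]
    exact lwE_mono _ _ _ fun x _ => abs_nonneg _
  have heven : ∀ x, f (-x) = f x := by
    intro x
    simp [hf]
  have hW : ∀ i, lwE n (fun x => f x * x i) = 0 := by
    intro i
    have h := lwE_neg n (fun x => f x * x i)
    have h2 : lwE n (fun x => f (-x) * (-x) i) = (-1) * lwE n (fun x => f x * x i) := by
      rw [← lwE_mul]
      congr 1
      funext x
      rw [heven]
      simp
    linarith
  have hL : ∀ x, lwL n f x ≤ f x := by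
    intro x
    have hup : ∀ k, ∑ i, a i * (Function.update x k (-x k)) i
        = (∑ i, a i * x i) - 2 * (a k * x k) := by
      intro k
      rw [← Finset.add_sum_erase _ _ (Finset.mem_univ k),
        ← Finset.add_sum_erase _ (fun i => a i * x i) (Finset.mem_univ k)]
      rw [Finset.sum_congr rfl (g := fun i => a i * x i)]
      · simp; ring
      · intro i hi
        rw [Function.update_of_ne (Finset.ne_of_mem_erase hi)]
    have htri : |∑ k : Fin n, ((∑ i, a i * x i) - 2 * (a k * x k))|
        ≤ ∑ k : Fin n, f (Function.update x k (-x k)) := by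
      refine (Finset.abs_sum_le_sum_abs _ _).trans (le_of_eq ?_)
      refine Finset.sum_congr rfl fun k _ => ?_
      simp only [hf, hup]
    rw [Finset.sum_sub_distrib, ← Finset.mul_sum, Finset.sum_const, Finset.card_univ,
      Fintype.card_fin, nsmul_eq_mul] at htri
    have h3 : ((n : ℝ) - 2) * f x ≤ |(n : ℝ) * (∑ i, a i * x i) - 2 * ∑ i, a i * x i| := by
      rw [← sub_mul, abs_mul]
      exact mul_le_mul_of_nonneg_right (le_abs_self _) (abs_nonneg _)
    have h4 : lwL n f x = ((n : ℝ) * f x - ∑ k : Fin n, f (Function.update x k (-x k))) / 2 := by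
      unfold lwL
      rw [← Finset.sum_div, Finset.sum_sub_distrib, Finset.sum_const, Finset.card_univ,
        Fintype.card_fin, nsmul_eq_mul]
    rw [h4]
    linarith
  have hD : lwE n (fun x => f x * lwL n f x) ≤ lwE n (fun x => f x * f x) :=
    lwE_mono _ _ _ fun x _ => mul_le_mul_of_nonneg_left (hL x) (abs_nonneg _)
  have hP := lw_poincare2 n f
  simp only [hW] at hP
  have h2m : lwE n (fun x => f x * f x) = ∑ i, a i ^ 2 := by
    have := lw_second_moment n a 0
    simp only [zero_add] at this
    simp only [hf, abs_mul_abs_self]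
    rw [this]
    simp
  rw [h2m] at hP hD
  simp at hP
  apply Real.sqrt_le_iff.2
  refine ⟨by positivity, ?_⟩
  rw [mul_pow, Real.sq_sqrt (by norm_num)]
  linarith

theorem lw_mixed (N : ℕ) (a : Fin N → Fin N → ℝ) (M : ℝ)
    (h : ∀ x y : Fin N → ℝ, (∀ i, |x i| ≤ 1) → (∀ j, |y j| ≤ 1) →
      ∑ i, x i * ∑ j, a i j * y j ≤ M) :
    ∑ i, Real.sqrt (∑ j, a i j ^ 2) ≤ Real.sqrt 2 * M := by
  calc ∑ i, Real.sqrt (∑ j, a i j ^ 2)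
      ≤ ∑ i, Real.sqrt 2 * lwE N (fun y => |∑ j, a i j * y j|) :=
        Finset.sum_le_sum fun i _ => lw_khinchine N (a i)
    _ = Real.sqrt 2 * lwE N (fun y => ∑ i, |∑ j, a i j * y j|) := by
        rw [lwE_sum, Finset.mul_sum]
    _ ≤ Real.sqrt 2 * M := by
        refine mul_le_mul_of_nonneg_left ?_ (Real.sqrt_nonneg _)
        rw [← lwE_const N M]
        refine lwE_mono _ _ _ fun y hy => ?_
        refine le_trans (le_of_eq ?_)
          (h (fun i => if 0 ≤ ∑ j, a i j * y j then 1 else -1) y ?_ hy)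
        · refine Finset.sum_congr rfl fun i _ => ?_
          split_ifs with h0
          · rw [abs_of_nonneg h0, one_mul]
          · rw [abs_of_neg (not_le.1 h0)]; ring
        · intro i
          split_ifs <;> simp

theorem lw_minkowski (N : ℕ) (a : Fin N → Fin N → ℝ) :
    Real.sqrt (∑ i, (∑ j, |a i j|) ^ 2) ≤ ∑ j, Real.sqrt (∑ i, a i j ^ 2) := by
  have := norm_sum_le (Finset.univ : Finset (Fin N))
    (fun j => (WithLp.toLp 2 (fun i => |a i j|) : EuclideanSpace ℝ (Fin N)))
  simpa [EuclideanSpace.norm_eq] using this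

theorem lw_holder (N : ℕ) (a : Fin N → Fin N → ℝ) (K : ℝ)
    (h1 : ∑ i, Real.sqrt (∑ j, a i j ^ 2) ≤ K)
    (h2 : ∑ j, Real.sqrt (∑ i, a i j ^ 2) ≤ K) :
    (∑ i, ∑ j, |a i j| ^ ((4 : ℝ) / 3)) ^ ((3 : ℝ) / 4) ≤ K := by
  have hK : 0 ≤ K := le_trans (Finset.sum_nonneg fun i _ => Real.sqrt_nonneg _) h1
  have hpq : Real.HolderConjugate 3 (3 / 2) := by
    rw [Real.holderConjugate_iff]; norm_num
  have inner : ∀ i, ∑ j, |a i j| ^ ((4 : ℝ) / 3)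
      ≤ (∑ j, a i j ^ 2) ^ ((1 : ℝ) / 3) * (∑ j, |a i j|) ^ ((2 : ℝ) / 3) := by
    intro i
    have := Real.inner_le_Lp_mul_Lq_of_nonneg Finset.univ hpq
      (f := fun j => |a i j| ^ ((2 : ℝ) / 3)) (g := fun j => |a i j| ^ ((2 : ℝ) / 3))
      (fun j _ => by positivity) (fun j _ => by positivity)
    refine le_trans (le_of_eq ?_) (this.trans (le_of_eq ?_))
    · refine Finset.sum_congr rfl fun j _ => ?_
      rw [← Real.rpow_add_of_nonneg (abs_nonneg _) (by norm_num) (by norm_num)]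
      norm_num
    · congr 1
      · congr 1
        refine Finset.sum_congr rfl fun j _ => ?_
        rw [← Real.rpow_mul (abs_nonneg _), ← sq_abs, ← Real.rpow_natCast]
        norm_num
      · congr 1
        · refine Finset.sum_congr rfl fun j _ => ?_
          rw [← Real.rpow_mul (abs_nonneg _)]
          norm_num
        · norm_num
  have outer : ∑ i, (∑ j, a i j ^ 2) ^ ((1 : ℝ) / 3) * (∑ j, |a i j|) ^ ((2 : ℝ) / 3)
      ≤ (∑ i, Real.sqrt (∑ j, a i j ^ 2)) ^ ((2 : ℝ) / 3)
        * (∑ i, (∑ j, |a i j|) ^ 2) ^ ((1 : ℝ) / 3) := by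
    have hA : ∀ i, 0 ≤ ∑ j, a i j ^ 2 := fun i => by positivity
    have hB : ∀ i, 0 ≤ ∑ j, |a i j| := fun i => by positivity
    have := Real.inner_le_Lp_mul_Lq_of_nonneg Finset.univ hpq.symm
      (f := fun i => (∑ j, a i j ^ 2) ^ ((1 : ℝ) / 3))
      (g := fun i => (∑ j, |a i j|) ^ ((2 : ℝ) / 3))
      (fun j _ => by positivity) (fun j _ => by positivity)
    refine this.trans (le_of_eq ?_)
    congr 1
    · congr 1
      · refine Finset.sum_congr rfl fun i _ => ?_
        rw [← Real.rpow_mul (hA i), Real.sqrt_eq_rpow]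
        norm_num
      · norm_num
    · congr 1
      refine Finset.sum_congr rfl fun i _ => ?_
      rw [← Real.rpow_mul (hB i), ← Real.rpow_natCast]
      norm_num
  have hmk : ∑ i, (∑ j, |a i j|) ^ 2 ≤ K ^ 2 :=
    (Real.sqrt_le_left hK).1 ((lw_minkowski N a).trans h2)
  have htot : ∑ i, ∑ j, |a i j| ^ ((4 : ℝ) / 3) ≤ K ^ ((4 : ℝ) / 3) := by
    refine (Finset.sum_le_sum fun i _ => inner i).trans (outer.trans ?_)
    calc _ ≤ K ^ ((2 : ℝ) / 3) * (K ^ 2) ^ ((1 : ℝ) / 3) := by gcongr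
      _ = K ^ ((4 : ℝ) / 3) := by
        rw [← Real.rpow_natCast, ← Real.rpow_mul hK,
          ← Real.rpow_add_of_nonneg hK (by norm_num) (by norm_num)]
        norm_num
  calc _ ≤ (K ^ ((4 : ℝ) / 3)) ^ ((3 : ℝ) / 4) := by gcongr
    _ = K := by
      rw [← Real.rpow_mul hK]
      norm_num

theorem lw_expand (N : ℕ) (A : (Fin N → ℝ) →ₗ[ℝ] (Fin N → ℝ) →ₗ[ℝ] ℝ) (x y : Fin N → ℝ) :
    A x y = ∑ i, x i * ∑ j, A (Pi.single i 1) (Pi.single j 1) * y j := by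
  have h : ∀ z : Fin N → ℝ, z = ∑ i, z i • (Pi.single i (1 : ℝ) : Fin N → ℝ) := by
    intro z
    funext j
    simp [Finset.sum_apply, Pi.single_apply]
  conv_lhs => rw [h x, h y]
  simp only [map_sum, map_smul, LinearMap.sum_apply, LinearMap.smul_apply, smul_eq_mul,
    Finset.mul_sum]
  rw [Finset.sum_comm]
  refine Finset.sum_congr rfl fun i _ => Finset.sum_congr rfl fun j _ => ?_
  ring

theorem lw_le_norm (N : ℕ) (A : (Fin N → ℝ) →ₗ[ℝ] (Fin N → ℝ) →ₗ[ℝ] ℝ) (x y : Fin N → ℝ)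
    (hx : ∀ i, |x i| ≤ 1) (hy : ∀ j, |y j| ≤ 1) : A x y ≤ bilinNorm N A := by
  refine (le_abs_self _).trans (le_csSup ?_ ⟨x, y, hx, hy, rfl⟩)
  refine ⟨∑ i, ∑ j, |A (Pi.single i 1) (Pi.single j 1)|, ?_⟩
  rintro t ⟨x, y, hx, hy, rfl⟩
  rw [lw_expand]
  refine (Finset.abs_sum_le_sum_abs _ _).trans (Finset.sum_le_sum fun i _ => ?_)
  rw [abs_mul]
  refine (mul_le_of_le_one_left (abs_nonneg _) (hx i)).trans ?_
  refine (Finset.abs_sum_le_sum_abs _ _).trans (Finset.sum_le_sum fun j _ => ?_)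
  rw [abs_mul]
  exact mul_le_of_le_one_right (abs_nonneg _) (hy j)

theorem real_littlewood_four_thirds (N : ℕ) (hN : 0 < N)
    (A : (Fin N → ℝ) →ₗ[ℝ] (Fin N → ℝ) →ₗ[ℝ] ℝ) :
    (∑ i : Fin N, ∑ j : Fin N, |A (Pi.single i 1) (Pi.single j 1)| ^ ((4 : ℝ) / 3))
        ^ ((3 : ℝ) / 4)
      ≤ Real.sqrt 2 * bilinNorm N A := by
  apply lw_holder N (fun i j => A (Pi.single i 1) (Pi.single j 1))
  · apply lw_mixed N (fun i j => A (Pi.single i 1) (Pi.single j 1))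
    intro x y hx hy
    rw [← lw_expand]
    exact lw_le_norm N A x y hx hy
  · apply lw_mixed N (fun j i => A (Pi.single i 1) (Pi.single j 1))
    intro x y hx hy
    refine le_trans (le_of_eq ?_) (lw_le_norm N A y x hy hx)
    rw [lw_expand]
    simp only [Finset.mul_sum]
    rw [Finset.sum_comm]
    refine Finset.sum_congr rfl fun i _ => Finset.sum_congr rfl fun j _ => ?_
    ring
end
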